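/- arXiv:2505.07051 — 2 statements merged into one kernel-verified Lean document; each statement's English description precedes it below -/
import Mathlib

section
/- For each prime p and ℓ ≥ 2, the limit as N → ∞ of (1/N) Σ_{n=1}^{N} B(ℓ, p^{v_p(n)}) / p^{(ℓ-1) v_p(n)} equals ∏_{j=2}^{ℓ} (1 - p^{-j})^{-1}, where v_p(n) is the p-adic valuation of n. -/
open Filter

/-- B(ℓ,n) as a sum over multiplicative flags d1 | d2 | ··· | d_{ℓ-1} | n. -/
def Bflag (ℓ n : ℕ) : ℕ :=
  ∑ d ∈ (Fintype.piFinset fun _ : Fin (ℓ-1) => Finset.range (n+1)) |>.filter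
      (fun d => (∀ i j : Fin (ℓ-1), (i:ℕ)+1 = (j:ℕ) → d i ∣ d j) ∧
        ∀ i : Fin (ℓ-1), (i:ℕ) = ℓ - 2 → d i ∣ n),
    ∏ i, d i

theorem dvd_of_Bflag_chain {m n : ℕ} {d : Fin m → ℕ}
    (h : ∀ i j : Fin m, (i : ℕ) + 1 = (j : ℕ) → d i ∣ d j)
    (hn : ∀ i : Fin m, (i : ℕ) = m - 1 → d i ∣ n) (i : Fin m) : d i ∣ n := by
  obtain ⟨k, hk⟩ : ∃ k, (i : ℕ) + k = m - 1 := ⟨m - 1 - i, by omega⟩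
  induction k generalizing i with
  | zero => exact hn i (by omega)
  | succ k ih =>
    exact (h i ⟨i + 1, by omega⟩ rfl).trans (ih _ (by simp only; omega))

theorem Bflag_one (n : ℕ) : Bflag 1 n = 1 := by
  simp [Bflag]

theorem Bflag_succ_succ (m : ℕ) {n : ℕ} (hn : n ≠ 0) :
    Bflag (m + 2) n = ∑ d ∈ n.divisors, d * Bflag (m + 1) d := by
  unfold Bflag
  simp only [Nat.add_sub_cancel, show m + 1 - 2 = m - 1 by omega]
  rw [← Finset.sum_fiberwise_of_maps_to (t := n.divisors) (g := fun d => d (Fin.last m))]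
  swap
  · intro d hd
    simp only [Finset.mem_filter] at hd
    exact Nat.mem_divisors.2 ⟨hd.2.2 _ rfl, hn⟩
  refine Finset.sum_congr rfl fun e he => ?_
  have hen := Nat.dvd_of_mem_divisors he
  have he0 : 0 < e := Nat.pos_of_mem_divisors he
  rw [Finset.mul_sum]
  refine Finset.sum_bij' (fun d _ => Fin.init d)
    (fun d _ => (Fin.snoc d e : Fin (m + 1) → ℕ)) ?_ ?_ ?_ ?_ ?_
  · intro d hd
    simp only [Finset.mem_filter] at hd
    obtain ⟨⟨-, hd, -⟩, hl⟩ := hd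
    have h1 : ∀ i j : Fin m, (i : ℕ) + 1 = (j : ℕ) → Fin.init d i ∣ Fin.init d j :=
      fun i j hij => hd i.castSucc j.castSucc (by simpa using hij)
    have h2 : ∀ i : Fin m, (i : ℕ) = m - 1 → Fin.init d i ∣ e := fun i hi => by
      rw [← hl]
      exact hd i.castSucc (Fin.last m) (by simp only [Fin.val_castSucc, Fin.val_last]; omega)
    simp only [Finset.mem_filter, Fintype.mem_piFinset, Finset.mem_range]
    exact ⟨fun i => Nat.lt_succ_of_le (Nat.le_of_dvd he0 (dvd_of_Bflag_chain h1 h2 i)), h1, h2⟩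
  · intro d hd
    simp only [Finset.mem_filter, Fintype.mem_piFinset, Finset.mem_range] at hd ⊢
    obtain ⟨h0, h1, h2⟩ := hd
    have hle := Nat.le_of_dvd (Nat.pos_of_ne_zero hn) hen
    refine ⟨⟨fun i => ?_, fun i j => ?_, fun i => ?_⟩, by simp⟩
    · refine Fin.lastCases ?_ (fun i => ?_) i
      · simp only [Fin.snoc_last]; omega
      · simp only [Fin.snoc_castSucc]; have := h0 i; omega
    · refine Fin.lastCases ?_ (fun i => ?_) i
      · intro h; simp only [Fin.val_last] at h; omega
      · refine Fin.lastCases ?_ (fun j => ?_) j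
        · intro h
          simp only [Fin.val_last, Fin.val_castSucc] at h
          simpa using h2 i (by omega)
        · intro h
          simpa using h1 i j (by simpa using h)
    · intro h
      obtain rfl : i = Fin.last m := Fin.ext h
      simpa using hen
  · intro d hd
    simp only [Finset.mem_filter] at hd
    rw [← hd.2]
    exact Fin.snoc_init_self d
  · intro d _
    exact Fin.init_snoc _ _
  · intro d hd
    simp only [Finset.mem_filter] at hd
    refine (Fin.prod_univ_castSucc d).trans ?_
    rw [hd.2, mul_comm]
    rfl

theorem Bflag_prime_pow_div {p : ℕ} (hp : p.Prime) (m a : ℕ) :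
    (Bflag (m + 2) (p ^ a) : ℝ) / (p : ℝ) ^ ((m + 1) * a) =
      ∑ b ∈ Finset.range (a + 1), (Bflag (m + 1) (p ^ b) : ℝ) / (p : ℝ) ^ (m * b) *
        ((1 / (p : ℝ)) ^ (m + 1)) ^ (a - b) := by
  have hp0 : (p : ℝ) ≠ 0 := by exact_mod_cast hp.ne_zero
  rw [Bflag_succ_succ m (pow_ne_zero _ hp.ne_zero), Nat.divisors_prime_pow hp, Finset.sum_map]
  push_cast
  rw [Finset.sum_div]
  refine Finset.sum_congr rfl fun b hb => ?_
  obtain ⟨c, rfl⟩ := Nat.exists_eq_add_of_le (Nat.lt_succ_iff.1 (Finset.mem_range.1 hb))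
  simp only [Function.Embedding.coeFn_mk, Nat.add_sub_cancel_left]
  push_cast
  rw [one_div, inv_pow, inv_pow, ← pow_mul, ← div_eq_mul_inv, div_div,
    div_eq_div_iff (by positivity) (by positivity)]
  ring

theorem hasSum_Bflag_prime_pow {p : ℕ} (hp : p.Prime) (m : ℕ) :
    HasSum (fun a => (Bflag (m + 1) (p ^ a) : ℝ) / (p : ℝ) ^ (m * a) * (1 / (p : ℝ)) ^ a)
      (∏ j ∈ Finset.range (m + 1), (1 - (1 / (p : ℝ)) ^ (j + 1))⁻¹) := by
  set x : ℝ := 1 / (p : ℝ) with hx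
  have hx0 : 0 ≤ x := by positivity
  have hx1 : x < 1 := by
    rw [hx, div_lt_one (by exact_mod_cast hp.pos)]
    exact_mod_cast hp.one_lt
  induction m with
  | zero => simpa [Bflag_one] using hasSum_geometric_of_lt_one hx0 hx1
  | succ m ih =>
    have hg := hasSum_geometric_of_lt_one (pow_nonneg hx0 (m + 2))
      (pow_lt_one₀ hx0 hx1 (by omega))
    have hi : Summable fun a => ‖(Bflag (m + 1) (p ^ a) : ℝ) / (p : ℝ) ^ (m * a) * x ^ a‖ :=
      ih.summable.norm
    have hg' : Summable fun a => ‖(x ^ (m + 2)) ^ a‖ := hg.summable.norm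
    have h := hasSum_sum_range_mul_of_summable_norm hi hg'
    rw [ih.tsum_eq, hg.tsum_eq] at h
    rw [Finset.prod_range_succ]
    refine h.congr_fun fun a => ?_
    rw [Bflag_prime_pow_div hp, Finset.sum_mul]
    refine Finset.sum_congr rfl fun b hb => ?_
    obtain ⟨c, rfl⟩ := Nat.exists_eq_add_of_le (Nat.lt_succ_iff.1 (Finset.mem_range.1 hb))
    rw [Nat.add_sub_cancel_left, ← hx]
    ring

theorem card_filter_factorization_eq {p : ℕ} (hp : p.Prime) (N k : ℕ) :
    (((Finset.Icc 1 N).filter fun n => n.factorization p = k).card : ℝ) =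
      ((N / p ^ k : ℕ) : ℝ) - ((N / p ^ (k + 1) : ℕ) : ℝ) := by
  have hc : ∀ j, ((Finset.Icc 1 N).filter fun n => j ≤ n.factorization p).card = N / p ^ j := by
    intro j
    rw [← Nat.Ioc_filter_dvd_card_eq_div]
    congr 1
    ext n
    simp only [Finset.mem_filter, Finset.mem_Icc, Finset.mem_Ioc]
    refine and_congr_right fun hn => ?_
    rw [hp.pow_dvd_iff_le_factorization (by omega)]
  rw [← hc, ← hc, eq_sub_iff_add_eq]
  norm_cast
  rw [← Finset.card_union_of_disjoint]
  · congr 1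
    ext n
    simp only [Finset.mem_union, Finset.mem_filter]
    grind
  · rw [Finset.disjoint_filter]
    intros; omega

theorem tendsto_natCast_div_div_atTop {d : ℕ} :
    Tendsto (fun N : ℕ => ((N / d : ℕ) : ℝ) / N) atTop (nhds (1 / (d : ℝ))) := by
  have h := (tendsto_nat_floor_mul_div_atTop (R := ℝ) (a := 1 / (d : ℝ)) (by positivity)).comp
    tendsto_natCast_atTop_atTop
  refine h.congr fun N => ?_
  simp only [Function.comp_apply]
  rw [one_div_mul_eq_div, Nat.floor_div_eq_div]

theorem tendsto_mean_comp_factorization {p : ℕ} (hp : p.Prime) {f : ℕ → ℝ} {s : ℝ}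
    (hf : ∀ k, 0 ≤ f k) (hs : HasSum (fun k => f k * (1 / (p : ℝ)) ^ k) s) :
    Tendsto (fun N : ℕ => (1 / (N : ℝ)) * ∑ n ∈ Finset.Icc 1 N, f (n.factorization p))
      atTop (nhds ((1 - 1 / (p : ℝ)) * s)) := by
  have hsum : ∀ N : ℕ, (1 / (N : ℝ)) * ∑ n ∈ Finset.Icc 1 N, f (n.factorization p) =
      ∑' k, f k * (((N / p ^ k : ℕ) : ℝ) / N - ((N / p ^ (k + 1) : ℕ) : ℝ) / N) := by
    intro N
    have hmaps : ∀ n ∈ Finset.Icc 1 N, n.factorization p ∈ Finset.range (N + 1) := by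
      intro n hn
      rw [Finset.mem_Icc] at hn
      have := Nat.factorization_lt p (n := n) (by omega)
      rw [Finset.mem_range]; omega
    rw [tsum_eq_sum (s := Finset.range (N + 1)), ← Finset.sum_fiberwise_of_maps_to hmaps,
      Finset.mul_sum]
    · refine Finset.sum_congr rfl fun k _ => ?_
      rw [Finset.sum_congr rfl (g := fun _ => f k)
        fun n hn => by rw [(Finset.mem_filter.1 hn).2], Finset.sum_const, nsmul_eq_mul,
        card_filter_factorization_eq hp]
      ring
    · intro k hk
      rw [← sub_div, ← card_filter_factorization_eq hp, Finset.filter_false_of_mem]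
      · simp
      · rintro n hn rfl
        exact hk (hmaps n hn)
  simp_rw [hsum]
  have hlim : (1 - 1 / (p : ℝ)) * s = ∑' k, f k * (1 / (p : ℝ) ^ k - 1 / (p : ℝ) ^ (k + 1)) := by
    rw [← hs.tsum_eq, ← tsum_mul_left]
    refine tsum_congr fun k => ?_
    rw [one_div_pow, pow_succ]
    ring
  rw [hlim]
  refine tendsto_tsum_of_dominated_convergence hs.summable (fun k => ?_) (.of_forall fun N k => ?_)
  · have h (j : ℕ) := tendsto_natCast_div_div_atTop (d := p ^ j)
    push_cast at h
    exact ((h k).sub (h (k + 1))).const_mul _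
  · rw [norm_mul, Real.norm_of_nonneg (hf k)]
    refine mul_le_mul_of_nonneg_left ?_ (hf k)
    rw [← sub_div, ← card_filter_factorization_eq hp, Real.norm_of_nonneg (by positivity),
      card_filter_factorization_eq hp, one_div_pow]
    rcases Nat.eq_zero_or_pos N with rfl | hN
    · simp
    rw [div_le_iff₀ (by exact_mod_cast hN)]
    have h : ((N / p ^ k : ℕ) : ℝ) ≤ (N : ℝ) / (p ^ k : ℕ) := Nat.cast_div_le
    push_cast at h
    rw [one_div_mul_eq_div]
    have : (0 : ℝ) ≤ ((N / p ^ (k + 1) : ℕ) : ℝ) := Nat.cast_nonneg _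
    linarith

/-- Cesàro mean over n ≤ N of B(ℓ, p^{v_p(n)})/p^{(ℓ-1)v_p(n)}
converges to ∏_{j=2}^ℓ (1-p^{-j})⁻¹. -/
theorem stmt_8 (ℓ : ℕ) (hℓ : 2 ≤ ℓ) (p : ℕ) (hp : p.Prime) :
    Tendsto (fun N : ℕ => (1 / (N : ℝ)) * ∑ n ∈ Finset.Icc 1 N,
        (Bflag ℓ (p ^ (n.factorization p)) : ℝ) / (p : ℝ) ^ ((ℓ - 1) * n.factorization p))
      atTop (nhds (∏ j ∈ Finset.Icc 2 ℓ, (1 - (1 / (p : ℝ)) ^ j)⁻¹)) := by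
  obtain ⟨m, rfl⟩ : ∃ m, ℓ = m + 1 := ⟨ℓ - 1, by omega⟩
  have h := tendsto_mean_comp_factorization hp
    (f := fun a => (Bflag (m + 1) (p ^ a) : ℝ) / (p : ℝ) ^ (m * a)) (fun _ => by positivity)
    (hasSum_Bflag_prime_pow hp m)
  convert! h using 2
  have hx : 1 - 1 / (p : ℝ) ≠ 0 := by
    rw [sub_ne_zero]
    have : (1 : ℝ) < p := by exact_mod_cast hp.one_lt
    exact ((div_lt_one (by linarith)).2 this).ne'
  rw [Finset.prod_range_succ', zero_add, pow_one, mul_comm, mul_assoc, inv_mul_cancel₀ hx, mul_one,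
    Finset.range_eq_Ico, Finset.prod_Ico_add' (fun j => (1 - (1 / (p : ℝ)) ^ j)⁻¹) 0 m 2]
  rfl
end

section
/- For ℓ ≥ 2 and n ≥ 1, A(ℓ,n,1) = (n-1)! · Σ over ℓ-tuples (f1,...,fℓ) of positive integers with f1···fℓ = n of f1^{ℓ-1} f2^{ℓ-2} ··· f_{ℓ-1}. -/
/-- B(ℓ,n) as a sum over ℓ-tuples of positive integers with product n. -/
def Btuple (ℓ n : ℕ) : ℕ :=
  ∑ f ∈ (Fintype.piFinset fun _ : Fin ℓ => Finset.range (n+1)) |>.filter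
      (fun f => ∏ i, f i = n),
    ∏ i : Fin ℓ, (f i) ^ (ℓ - 1 - (i : ℕ))

open Multiplicative (ofAdd toAdd)

theorem index_zpowers_ofAdd (a : ℤ) : (Subgroup.zpowers (ofAdd a)).index = a.natAbs :=
  Int.index_zmultiples a

theorem eq_zpowers_ofAdd_index (H : Subgroup (Multiplicative ℤ)) :
    H = Subgroup.zpowers (ofAdd (H.index : ℤ)) := by
  obtain ⟨g, hg⟩ := (Subgroup.isCyclic_iff_exists_zpowers_eq_top H).1 inferInstance
  have hi : H.index = (toAdd g).natAbs := by rw [← hg]; exact index_zpowers_ofAdd (toAdd g)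
  rw [hi]
  rcases Int.natAbs_eq (toAdd g) with h | h
  · rw [← h]; exact hg.symm
  · have : ofAdd ((toAdd g).natAbs : ℤ) = g⁻¹ := by
      rw [← neg_eq_iff_eq_neg.2 h]; rfl
    rw [this, Subgroup.zpowers_inv, hg]

section Extension

variable {A B : Type*} [CommGroup A] [CommGroup B]

theorem index_eq_index_comap_inl_mul_index_map_snd (K : Subgroup (A × B)) :
    K.index = (K.comap (MonoidHom.inl A B)).index * (K.map (MonoidHom.snd A B)).index := by
  have hr : (MonoidHom.inl A B).range = (MonoidHom.snd A B).ker := by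
    ext ⟨x, y⟩
    simp only [MonoidHom.mem_range, MonoidHom.inl_apply, Prod.mk.injEq, exists_eq_left,
      MonoidHom.mem_ker, MonoidHom.coe_snd]
    exact eq_comm
  rw [Subgroup.index_map, MonoidHom.range_eq_top.2 Prod.snd_surjective, Subgroup.index_top, mul_one,
    Subgroup.index_comap, hr, ← Subgroup.relIndex_sup_left, Subgroup.relIndex_mul_index le_sup_left]

/-- The subgroup of `A × ℤ` generated by `L × 0` and the elements `(x, d)` with `x` in the
class `q` modulo `L`. -/
def extendSubgroup (d : ℕ) (L : Subgroup A) (q : A ⧸ L) : Subgroup (A × Multiplicative ℤ) where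
  carrier := {p | ∃ j : ℤ, p.2 = ofAdd (d : ℤ) ^ j ∧ (p.1 : A ⧸ L) = q ^ j}
  mul_mem' := by
    rintro a b ⟨i, hi, hi'⟩ ⟨j, hj, hj'⟩
    exact ⟨i + j, by simp [hi, hj, zpow_add], by simp [hi', hj', zpow_add]⟩
  one_mem' := ⟨0, by simp, by simp⟩
  inv_mem' := by
    rintro a ⟨i, hi, hi'⟩
    exact ⟨-i, by simp [hi], by simp [hi']⟩

theorem map_snd_extendSubgroup (d : ℕ) (L : Subgroup A) (q : A ⧸ L) :
    (extendSubgroup d L q).map (MonoidHom.snd A _) = Subgroup.zpowers (ofAdd (d : ℤ)) := by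
  ext k
  constructor
  · rintro ⟨p, ⟨j, hj, -⟩, rfl⟩
    exact ⟨j, hj.symm⟩
  · rintro ⟨j, rfl⟩
    obtain ⟨x, hx⟩ := QuotientGroup.mk_surjective (q ^ j)
    exact ⟨(x, _), ⟨j, rfl, hx⟩, rfl⟩

theorem ofAdd_zpow_injective {d : ℕ} (hd : d ≠ 0) :
    Function.Injective fun j : ℤ => ofAdd (d : ℤ) ^ j := by
  intro i j h
  have h' : i * (d : ℤ) = j * d := h
  exact mul_right_cancel₀ (by exact_mod_cast hd) h'

theorem mk_mem_extendSubgroup_zpow {d : ℕ} (hd : d ≠ 0) {L : Subgroup A} {q : A ⧸ L} {x : A}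
    {j : ℤ} : (x, ofAdd (d : ℤ) ^ j) ∈ extendSubgroup d L q ↔ (x : A ⧸ L) = q ^ j := by
  constructor
  · rintro ⟨i, hi, hi'⟩
    obtain rfl := ofAdd_zpow_injective hd hi
    exact hi'
  · exact fun h => ⟨j, rfl, h⟩

theorem comap_inl_extendSubgroup {d : ℕ} (hd : d ≠ 0) (L : Subgroup A) (q : A ⧸ L) :
    (extendSubgroup d L q).comap (MonoidHom.inl A _) = L := by
  ext x
  have := mk_mem_extendSubgroup_zpow hd (q := q) (x := x) (j := 0)
  simpa using this

theorem exists_eq_extendSubgroup (K : Subgroup (A × Multiplicative ℤ)) :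
    ∃ (d : ℕ) (L : Subgroup A) (q : A ⧸ L), d * L.index = K.index ∧ extendSubgroup d L q = K := by
  set d := (K.map (MonoidHom.snd A _)).index with hd
  have hmap := eq_zpowers_ofAdd_index (K.map (MonoidHom.snd A _))
  rw [← hd] at hmap
  obtain ⟨⟨x, k⟩, hx, hk⟩ : ofAdd (d : ℤ) ∈ K.map (MonoidHom.snd A _) := by
    rw [hmap]; exact Subgroup.mem_zpowers _
  obtain rfl : k = ofAdd (d : ℤ) := hk
  refine ⟨d, K.comap (MonoidHom.inl A _), x, ?_, ?_⟩
  · rw [index_eq_index_comap_inl_mul_index_map_snd K, mul_comm]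
  have key : ∀ (y : A) (j : ℤ), (y, ofAdd (d : ℤ) ^ j) ∈ K ↔
      (y : A ⧸ K.comap (MonoidHom.inl A (Multiplicative ℤ))) = (x : A ⧸ _) ^ j := by
    intro y j
    rw [eq_comm, ← QuotientGroup.mk_zpow, QuotientGroup.eq, Subgroup.mem_comap,
      ← Subgroup.mul_mem_cancel_left K (K.inv_mem (K.zpow_mem hx j))]
    simp
  ext ⟨y, k⟩
  constructor
  · rintro ⟨j, hj, hj'⟩
    obtain rfl : k = _ := hj
    exact (key y j).2 hj'
  · intro h
    have hk : k ∈ K.map (MonoidHom.snd A _) := ⟨_, h, rfl⟩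
    rw [hmap] at hk
    obtain ⟨j, rfl⟩ := hk
    exact ⟨j, rfl, (key y j).1 h⟩

theorem index_extendSubgroup {d : ℕ} (hd : d ≠ 0) (L : Subgroup A) (q : A ⧸ L) :
    (extendSubgroup d L q).index = d * L.index := by
  rw [index_eq_index_comap_inl_mul_index_map_snd, comap_inl_extendSubgroup hd,
    map_snd_extendSubgroup, index_zpowers_ofAdd, Int.natAbs_natCast, mul_comm]

/-- A subgroup of index `n ≠ 0` of `A × ℤ` amounts to a factorization `n = d * m`, a subgroup
`L` of `A` of index `m` and an element of `A ⧸ L`. -/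
noncomputable def sigmaEquivSubgroupProdIndexEq (A : Type*) [CommGroup A] {n : ℕ} (hn : n ≠ 0) :
    (Σ p : n.divisorsAntidiagonal, Σ L : {L : Subgroup A // L.index = p.1.2}, A ⧸ L.1) ≃
      {K : Subgroup (A × Multiplicative ℤ) // K.index = n} := by
  have hd : ∀ p ∈ n.divisorsAntidiagonal, p.1 ≠ 0 := fun p hp =>
    (Nat.ne_zero_of_mem_divisorsAntidiagonal hp).1
  refine Equiv.ofBijective (fun t => ⟨extendSubgroup t.1.1.1 t.2.1.1 t.2.2, ?_⟩) ⟨?_, ?_⟩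
  · rw [index_extendSubgroup (hd _ t.1.2), t.2.1.2]
    exact (Nat.mem_divisorsAntidiagonal.1 t.1.2).1
  · rintro ⟨⟨⟨d, m⟩, hp⟩, ⟨L, hL⟩, q⟩ ⟨⟨⟨d', m'⟩, hp'⟩, ⟨L', hL'⟩, q'⟩ h
    replace h : extendSubgroup d L q = extendSubgroup d' L' q' := congrArg Subtype.val h
    have h0 : d ≠ 0 := hd _ hp
    have h0' : d' ≠ 0 := hd _ hp'
    obtain rfl : L = L' := by
      rw [← comap_inl_extendSubgroup h0 L q, h, comap_inl_extendSubgroup h0']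
    obtain rfl : d = d' := by
      have := congrArg (fun K => (K.map (MonoidHom.snd A _)).index) h
      simpa [map_snd_extendSubgroup, index_zpowers_ofAdd] using this
    obtain rfl : m = m' := hL.symm.trans hL'
    obtain rfl : q = q' := by
      obtain ⟨x, rfl⟩ := QuotientGroup.mk_surjective q
      have hx := (mk_mem_extendSubgroup_zpow h0 (q := (x : A ⧸ L)) (j := 1)).2 (zpow_one _).symm
      rw [h, mk_mem_extendSubgroup_zpow h0, zpow_one] at hx
      exact hx
    rfl
  · rintro ⟨K, hK⟩
    obtain ⟨d, L, q, hdL, rfl⟩ := exists_eq_extendSubgroup K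
    exact ⟨⟨⟨(d, L.index), Nat.mem_divisorsAntidiagonal.2 ⟨hdL.trans hK, hn⟩⟩, ⟨L, rfl⟩, q⟩, rfl⟩

end Extension

theorem finite_subgroup_index_eq_and_card_prod {A : Type*} [CommGroup A]
    (hA : ∀ m ≠ 0, Finite {L : Subgroup A // L.index = m}) {n : ℕ} (hn : n ≠ 0) :
    Finite {K : Subgroup (A × Multiplicative ℤ) // K.index = n} ∧
    Nat.card {K : Subgroup (A × Multiplicative ℤ) // K.index = n} =
      ∑ p ∈ n.divisorsAntidiagonal, p.2 * Nat.card {L : Subgroup A // L.index = p.2} := by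
  have h0 : ∀ p : n.divisorsAntidiagonal, p.1.2 ≠ 0 := fun p =>
    (Nat.ne_zero_of_mem_divisorsAntidiagonal p.2).2
  have hL (p : n.divisorsAntidiagonal) : Finite {L : Subgroup A // L.index = p.1.2} := hA _ (h0 p)
  have hq (p : n.divisorsAntidiagonal) (L : {L : Subgroup A // L.index = p.1.2}) :
      Finite (A ⧸ L.1) := by
    have : L.1.FiniteIndex := ⟨by rw [L.2]; exact h0 p⟩
    infer_instance
  refine ⟨.of_equiv _ (sigmaEquivSubgroupProdIndexEq A hn), ?_⟩
  rw [← Nat.card_congr (sigmaEquivSubgroupProdIndexEq A hn), Nat.card_sigma,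
    ← Finset.sum_coe_sort n.divisorsAntidiagonal
      fun p => p.2 * Nat.card {L : Subgroup A // L.index = p.2}]
  refine Finset.sum_congr rfl fun p _ => ?_
  have := Fintype.ofFinite {L : Subgroup A // L.index = p.1.2}
  rw [Nat.card_sigma, Finset.sum_congr rfl fun L _ => L.2, Finset.sum_const, Finset.card_univ,
    Nat.card_eq_fintype_card, smul_eq_mul, mul_comm]

theorem Btuple_eq_sum_finMulAntidiag (ℓ : ℕ) {n : ℕ} (hn : n ≠ 0) :
    Btuple ℓ n = ∑ f ∈ Nat.finMulAntidiag ℓ n, ∏ i : Fin ℓ, f i ^ (ℓ - 1 - (i : ℕ)) := by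
  refine Finset.sum_congr ?_ fun _ _ => rfl
  ext f
  simp only [Finset.mem_filter, Fintype.mem_piFinset, Finset.mem_range, Nat.mem_finMulAntidiag]
  refine ⟨fun h => ⟨h.2, hn⟩, fun h => ⟨fun i => Nat.lt_succ_of_le ?_, h.1⟩⟩
  exact Nat.le_of_dvd (Nat.pos_of_ne_zero hn) (h.1 ▸ Finset.dvd_prod_of_mem f (Finset.mem_univ i))

theorem Btuple_zero {n : ℕ} : Btuple 0 n = if n = 1 then 1 else 0 := by
  by_cases h : n = 1 <;> simp [Btuple, h, eq_comm]

theorem Btuple_succ (ℓ : ℕ) {n : ℕ} (hn : n ≠ 0) :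
    Btuple (ℓ + 1) n = ∑ p ∈ n.divisorsAntidiagonal, p.2 * Btuple ℓ p.2 := by
  have h0 : ∀ p ∈ n.divisorsAntidiagonal, p.2 ≠ 0 := fun p hp =>
    (Nat.ne_zero_of_mem_divisorsAntidiagonal hp).2
  have hB : ∀ p ∈ n.divisorsAntidiagonal, p.2 * Btuple ℓ p.2 =
      ∑ f ∈ Nat.finMulAntidiag ℓ p.2, p.2 * ∏ i : Fin ℓ, f i ^ (ℓ - 1 - (i : ℕ)) := fun p hp => by
    rw [Btuple_eq_sum_finMulAntidiag ℓ (h0 p hp), Finset.mul_sum]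
  rw [Btuple_eq_sum_finMulAntidiag _ hn, Finset.sum_congr rfl hB, Finset.sum_sigma']
  refine Finset.sum_bij' (fun f _ => ⟨(f (Fin.last ℓ), ∏ i : Fin ℓ, f i.castSucc), Fin.init f⟩)
    (fun t _ => Fin.snoc t.2 t.1.1) ?_ ?_ ?_ ?_ ?_
  · intro f hf
    rw [Nat.mem_finMulAntidiag, Fin.prod_univ_castSucc] at hf
    have : (∏ i : Fin ℓ, f i.castSucc) ≠ 0 := fun h => hf.2 (by rw [← hf.1, h, zero_mul])
    simp only [Finset.mem_sigma, Nat.mem_divisorsAntidiagonal, Nat.mem_finMulAntidiag]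
    exact ⟨⟨by rw [mul_comm, hf.1], hn⟩, rfl, this⟩
  · rintro ⟨⟨d, m⟩, f⟩ ht
    simp only [Finset.mem_sigma, Nat.mem_divisorsAntidiagonal, Nat.mem_finMulAntidiag] at ht
    simp [Nat.mem_finMulAntidiag, Fin.prod_univ_castSucc, ht.2.1, mul_comm m, ht.1.1, hn]
  · intro f _
    simp
  · rintro ⟨⟨d, m⟩, f⟩ ht
    simp only [Finset.mem_sigma, Nat.mem_divisorsAntidiagonal, Nat.mem_finMulAntidiag] at ht
    simp [ht.2.1]
  · intro f _
    rw [Fin.prod_univ_castSucc]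
    simp only [Fin.init, Fin.val_castSucc, Fin.val_last, add_tsub_cancel_right, tsub_self, pow_zero,
      mul_one]
    rw [← Finset.prod_mul_distrib]
    refine Finset.prod_congr rfl fun i _ => ?_
    rw [← pow_succ']
    congr 1
    omega

/-- Splitting off the first coordinate, as an isomorphism of groups. -/
def piFinSuccMulEquiv (M : Type*) [Mul M] (ℓ : ℕ) :
    (Fin (ℓ + 1) → M) ≃* (Fin ℓ → M) × M where
  toFun f := (Fin.tail f, f 0)
  invFun p := Fin.cons p.2 p.1
  left_inv f := by simp
  right_inv p := by simp
  map_mul' _ _ := rfl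

/-- Isomorphic groups have the same subgroups of a given index. -/
def subgroupIndexEqCongr {G H : Type*} [Group G] [Group H] (e : G ≃* H) (n : ℕ) :
    {K : Subgroup G // K.index = n} ≃ {K : Subgroup H // K.index = n} :=
  e.mapSubgroup.toEquiv.subtypeEquiv fun K => by
    simp [Subgroup.index_map_equiv]

theorem finite_and_card_subgroup_index_eq (ℓ : ℕ) : ∀ n ≠ 0,
    Finite {K : Subgroup (Fin ℓ → Multiplicative ℤ) // K.index = n} ∧
    Nat.card {K : Subgroup (Fin ℓ → Multiplicative ℤ) // K.index = n} = Btuple ℓ n := by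
  induction ℓ with
  | zero =>
    intro n hn
    refine ⟨inferInstance, ?_⟩
    have hK (K : Subgroup (Fin 0 → Multiplicative ℤ)) : K.index = 1 := by
      rw [Subgroup.index_eq_one]; exact Subsingleton.elim _ _
    rw [Btuple_zero]
    split_ifs with h
    · subst h
      simp [hK]
    · simp [hK, Ne.symm h]
  | succ ℓ ih =>
    intro n hn
    have := finite_subgroup_index_eq_and_card_prod (fun m hm => (ih m hm).1) hn
    have h0 : ∀ p ∈ n.divisorsAntidiagonal, p.2 ≠ 0 := fun p hp =>
      (Nat.ne_zero_of_mem_divisorsAntidiagonal hp).2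
    have e := subgroupIndexEqCongr (piFinSuccMulEquiv (Multiplicative ℤ) ℓ) n
    refine ⟨(Equiv.finite_iff e).2 this.1, ?_⟩
    rw [Nat.card_congr e, this.2, Btuple_succ ℓ hn]
    exact Finset.sum_congr rfl fun p hp => by rw [(ih _ (h0 p hp)).2]

/-- A permutation representation on `X` is transitive. -/
def IsTransitiveHom {G X : Type*} [Group G] (φ : G →* Equiv.Perm X) : Prop :=
  ∀ x y, ∃ g, φ g x = y

section TransitiveHom

variable {G X : Type*} [Group G]

/-- The permutation representation on `X` obtained from `G ⧸ K` through a bijection. -/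
def quotientPermHom (K : Subgroup G) (e : X ≃ G ⧸ K) : G →* Equiv.Perm X :=
  e.symm.permCongrHom.toMonoidHom.comp (MulAction.toPermHom G (G ⧸ K))

theorem quotientPermHom_apply (K : Subgroup G) (e : X ≃ G ⧸ K) (g : G) (x : X) :
    quotientPermHom K e g x = e.symm (g • e x) :=
  rfl

theorem isTransitiveHom_quotientPermHom (K : Subgroup G) (e : X ≃ G ⧸ K) :
    IsTransitiveHom (quotientPermHom K e) := by
  intro x y
  obtain ⟨g, hg⟩ := MulAction.exists_smul_eq G (e x) (e y)
  exact ⟨g, by rw [quotientPermHom_apply, hg, e.symm_apply_apply]⟩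

theorem quotientPermHom_apply_base {K : Subgroup G} {e : X ≃ G ⧸ K} {x₀ : X}
    (he : e x₀ = (1 : G)) (g : G) : quotientPermHom K e g x₀ = e.symm g := by
  rw [quotientPermHom_apply, he, MulAction.Quotient.smul_coe, smul_eq_mul, mul_one]

theorem exists_quotientPermHom_eq {φ : G →* Equiv.Perm X} (hφ : IsTransitiveHom φ) (x₀ : X) :
    ∃ (K : Subgroup G) (e : X ≃ G ⧸ K), e x₀ = (1 : G) ∧ quotientPermHom K e = φ := by
  let := MulAction.compHom X φ
  have hsmul (g : G) (x : X) : g • x = φ g x := rfl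
  let f : G ⧸ MulAction.stabilizer G x₀ ≃ X :=
    Equiv.ofBijective (MulAction.ofQuotientStabilizer G x₀)
      ⟨MulAction.injective_ofQuotientStabilizer G x₀,
        fun y => (hφ x₀ y).imp' QuotientGroup.mk fun _ h => h⟩
  refine ⟨_, f.symm, ?_, ?_⟩
  · rw [Equiv.symm_apply_eq]
    exact (one_smul G x₀).symm
  · ext g x
    rw [quotientPermHom_apply, Equiv.symm_symm, ← hsmul]
    conv_rhs => rw [← f.apply_symm_apply x]
    exact MulAction.ofQuotientStabilizer_smul G x₀ g (f.symm x)

/-- A transitive permutation representation on a set with a base point amounts to a subgroup, the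
stabilizer of the base point, together with a pointed bijection to the cosets. -/
noncomputable def sigmaEquivTransitiveHom (G : Type*) [Group G] [Finite X] (x₀ : X) :
    (Σ K : {K : Subgroup G // K.index = Nat.card X}, {e : X ≃ G ⧸ K.1 // e x₀ = (1 : G)}) ≃
      {φ : G →* Equiv.Perm X // IsTransitiveHom φ} := by
  refine Equiv.ofBijective
    (fun t => ⟨quotientPermHom t.1.1 t.2.1, isTransitiveHom_quotientPermHom _ _⟩) ⟨?_, ?_⟩
  · rintro ⟨⟨K, hK⟩, e, he⟩ ⟨⟨K', hK'⟩, e', he'⟩ h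
    replace h : quotientPermHom K e = quotientPermHom K' e' := congrArg Subtype.val h
    have hg (g : G) : e.symm g = e'.symm g := by
      rw [← quotientPermHom_apply_base he, h, quotientPermHom_apply_base he']
    have mem_iff {L : Subgroup G} {e : X ≃ G ⧸ L} (he : e x₀ = (1 : G)) (g : G) :
        g ∈ L ↔ e.symm g = x₀ := by
      rw [Equiv.symm_apply_eq, he, eq_comm, QuotientGroup.eq, inv_one, one_mul]
    obtain rfl : K = K' := by
      ext g
      rw [mem_iff he, mem_iff he', hg]
    obtain rfl : e = e' := by
      apply Equiv.symm_bijective.injective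
      ext q
      obtain ⟨g, rfl⟩ := QuotientGroup.mk_surjective q
      exact hg g
    rfl
  · rintro ⟨φ, hφ⟩
    obtain ⟨K, e, he, rfl⟩ := exists_quotientPermHom_eq hφ x₀
    exact ⟨⟨⟨K, (Nat.card_congr e).symm⟩, e, he⟩, rfl⟩

end TransitiveHom

theorem card_pointed_equiv {X Y : Type*} [Finite X] (h : Nat.card Y = Nat.card X) (x₀ : X)
    (y₀ : Y) : Nat.card {e : X ≃ Y // e x₀ = y₀} = (Nat.card X - 1).factorial := by
  classical
  have hX : 0 < Nat.card X := Nat.card_pos_iff.2 ⟨⟨x₀⟩, inferInstance⟩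
  have : Finite Y := Nat.finite_of_card_ne_zero (by omega)
  have := Fintype.ofFinite X
  have := Fintype.ofFinite Y
  have hX' : Fintype.card {x // x ≠ x₀} = Nat.card X - 1 := by
    rw [Nat.card_eq_fintype_card]; exact Set.card_ne_eq x₀
  have hY' : Fintype.card {y // y ≠ y₀} = Nat.card X - 1 := by
    rw [← h, Nat.card_eq_fintype_card]; exact Set.card_ne_eq y₀
  have e₁ : {e : X ≃ Y // e x₀ = y₀} ≃ {e : Option {x // x ≠ x₀} ≃ Y // e none = y₀} :=
    (Equiv.equivCongr (Equiv.optionSubtypeNe x₀).symm (Equiv.refl Y)).subtypeEquiv fun e => by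
      simp
  rw [Nat.card_congr (e₁.trans (Equiv.optionSubtype y₀)), Nat.card_eq_fintype_card,
    Fintype.card_equiv (Fintype.equivOfCardEq (hX'.trans hY'.symm)), hX']

theorem card_transitiveHom {G X : Type*} [Group G] [Finite X] [Nonempty X]
    (hG : Finite {K : Subgroup G // K.index = Nat.card X}) :
    Nat.card {φ : G →* Equiv.Perm X // IsTransitiveHom φ} =
      (Nat.card X - 1).factorial * Nat.card {K : Subgroup G // K.index = Nat.card X} := by
  obtain ⟨x₀⟩ := ‹Nonempty X›
  have hcard (K : {K : Subgroup G // K.index = Nat.card X}) :=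
    card_pointed_equiv K.2 x₀ ((1 : G) : G ⧸ K.1)
  have hfin (K : {K : Subgroup G // K.index = Nat.card X}) :
      Finite {e : X ≃ G ⧸ K.1 // e x₀ = (1 : G)} :=
    Nat.finite_of_card_ne_zero (by rw [hcard K]; positivity)
  have := Fintype.ofFinite {K : Subgroup G // K.index = Nat.card X}
  rw [← Nat.card_congr (sigmaEquivTransitiveHom G x₀), Nat.card_sigma,
    Finset.sum_congr rfl fun K _ => hcard K, Finset.sum_const, Finset.card_univ,
    ← Nat.card_eq_fintype_card, smul_eq_mul, mul_comm]

theorem pairwise_commute_zpowersHom {ι M : Type*} [Group M] {π : ι → M}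
    (h : ∀ i j, π i * π j = π j * π i) :
    Pairwise fun i j => ∀ x y, Commute (zpowersHom M (π i) x) (zpowersHom M (π j) y) := by
  intro i j _ x y
  rw [zpowersHom_apply, zpowersHom_apply]
  exact ((commute_iff_eq _ _).2 (h i j)).zpow_zpow _ _

/-- Commuting tuples of elements of `M` amount to homomorphisms from a power of `ℤ`. -/
def commutingTuplesEquivHom (ι M : Type*) [Fintype ι] [DecidableEq ι] [Group M] :
    {π : ι → M // ∀ i j, π i * π j = π j * π i} ≃ ((ι → Multiplicative ℤ) →* M) :=
  ((Equiv.piCongrRight fun _ => zpowersHom M).subtypeEquiv fun π =>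
    ⟨pairwise_commute_zpowersHom, fun h i j => by
      obtain rfl | hij := eq_or_ne i j
      · rfl
      · simpa using (h hij (ofAdd 1) (ofAdd 1)).eq⟩).trans
  MonoidHom.noncommPiCoprodEquiv

theorem range_commutingTuplesEquivHom {ι M : Type*} [Fintype ι] [DecidableEq ι] [Group M]
    (π : {π : ι → M // ∀ i j, π i * π j = π j * π i}) :
    (commutingTuplesEquivHom ι M π).range = Subgroup.closure (Set.range π.1) := by
  have h : commutingTuplesEquivHom ι M π = MonoidHom.noncommPiCoprod
      (fun i => zpowersHom M (π.1 i)) (pairwise_commute_zpowersHom π.2) := rfl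
  rw [h, MonoidHom.noncommPiCoprod_range, ← Set.iUnion_singleton_eq_range, Subgroup.closure_iUnion]
  refine iSup_congr fun i => ?_
  rw [← Subgroup.zpowers_eq_closure]
  rfl

theorem isPretransitive_range_iff {G X : Type*} [Group G] (φ : G →* Equiv.Perm X) :
    MulAction.IsPretransitive φ.range X ↔ IsTransitiveHom φ := by
  constructor
  · rintro ⟨h⟩ x y
    obtain ⟨⟨_, g, rfl⟩, hg⟩ := h x y
    exact ⟨g, hg⟩
  · refine fun h => ⟨fun x y => ?_⟩
    obtain ⟨g, hg⟩ := h x y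
    exact ⟨⟨φ g, g, rfl⟩, hg⟩

/-- the number of ℓ-tuples of pairwise commuting permutations of
{1,...,n} generating a transitive subgroup equals (n-1)!·B(ℓ,n). -/
theorem stmt_14 (ℓ n : ℕ) (hℓ : 2 ≤ ℓ) (hn : 1 ≤ n) :
    Nat.card {π : Fin ℓ → Equiv.Perm (Fin n) //
        (∀ i j : Fin ℓ, π i * π j = π j * π i) ∧
        MulAction.IsPretransitive (Subgroup.closure (Set.range π)) (Fin n)} =
      (n - 1).factorial * Btuple ℓ n := by
  have : Nonempty (Fin n) := ⟨⟨0, hn⟩⟩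
  obtain ⟨hfin, hcard⟩ := finite_and_card_subgroup_index_eq ℓ n (by omega)
  have key := card_transitiveHom (G := Fin ℓ → Multiplicative ℤ) (X := Fin n)
    (by rwa [Nat.card_fin])
  rw [Nat.card_fin, hcard] at key
  rw [← key]
  refine Nat.card_congr ((Equiv.subtypeSubtypeEquivSubtypeInter _ _).symm.trans
    ((commutingTuplesEquivHom (Fin ℓ) (Equiv.Perm (Fin n))).subtypeEquiv fun π => ?_))
  rw [← isPretransitive_range_iff, range_commutingTuplesEquivHom]
end
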